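/- arXiv:1701.01208 — 2 statements merged into one kernel-verified Lean document; each statement's English description precedes it below -/
import Mathlib

section
/- Let G be a finite connected simple graph with at least 3 vertices and let p be a prime. Then p² divides [Ψ_G]_p, the number of points x ∈ 𝔽_p^{E(G)} with Ψ_G(x) = 0. (This is the fact that the c₂ invariant c₂^{(p)}(G) = [Ψ_G]_p/p² mod p is well defined.) -/
open SimpleGraph
open scoped Classical

/-- `T` is (the edge set of) a spanning tree of `G`. -/
def IsSpanningTree {V : Type} (G : SimpleGraph V) (T : Set (Sym2 V)) : Prop :=
  T ⊆ G.edgeSet ∧ (SimpleGraph.fromEdgeSet T).Connected ∧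
    (SimpleGraph.fromEdgeSet T).IsAcyclic

/-- The Kirchhoff polynomial `Ψ_G = Σ_T ∏_{e ∉ T} α_e`, summed over spanning trees. -/
noncomputable def kirchhoff {V : Type} [Fintype V] (G : SimpleGraph V) :
    MvPolynomial G.edgeSet ℤ :=
  ∑ T ∈ G.edgeFinset.powerset.filter
      (fun T : Finset (Sym2 V) => IsSpanningTree G (T : Set (Sym2 V))),
    ∏ e : G.edgeSet, if (e : Sym2 V) ∈ T then 1 else MvPolynomial.X e

/-- `[Ψ_G]_p`: the number of points `x ∈ 𝔽_p^{E(G)}` with `Ψ_G(x) = 0`. -/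
noncomputable def zeroCount {V : Type} [Fintype V] (G : SimpleGraph V) (p : ℕ) : ℕ :=
  Nat.card {x : G.edgeSet → ZMod p //
    MvPolynomial.eval x (MvPolynomial.map (Int.castRingHom (ZMod p)) (kirchhoff G)) = 0}

section Determinants

open Matrix Finset

variable {E κ : Type*} [Fintype κ] [DecidableEq E]

/-- The principal minor of `B * Bᵀ` on the rows in `T`. -/
def gramMinor {R : Type*} [CommRing R] (B : Matrix E κ R) (T : Finset E) : R :=
  ((B * Bᵀ).submatrix (Subtype.val : T → E) Subtype.val).det

lemma gramMinor_map {R S : Type*} [CommRing R] [CommRing S] (φ : R →+* S) (B : Matrix E κ R)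
    (T : Finset E) : gramMinor (B.map φ) T = φ (gramMinor B T) := by
  rw [gramMinor, gramMinor, RingHom.map_det, RingHom.mapMatrix_apply, ← transpose_map,
    ← Matrix.map_mul, submatrix_map]

lemma gramMinor_congr {R : Type*} [CommRing R] {B B' : Matrix E κ R} {T : Finset E}
    (h : ∀ e ∈ T, B e = B' e) : gramMinor B T = gramMinor B' T := by
  unfold gramMinor
  congr 1
  ext i j
  simp [mul_apply, h i i.2, h j j.2]

lemma gramMinor_eq_zero_of_row {R : Type*} [CommRing R] {B : Matrix E κ R} {T : Finset E}
    {e : E} (he : e ∈ T) (h : B e = 0) : gramMinor B T = 0 := by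
  refine det_eq_zero_of_row_eq_zero ⟨e, he⟩ fun j => ?_
  simp [mul_apply, h]

lemma gramMinor_eq_det_sq [DecidableEq κ] {R : Type*} [CommRing R] (B : Matrix E κ R) (T : Finset E)
    (σ : κ ≃ T) : gramMinor B T = (B.submatrix (fun k => (σ k : E)) id).det ^ 2 := by
  rw [gramMinor, ← det_submatrix_equiv_self σ, pow_two]
  nth_rw 3 [← det_transpose]
  rw [← det_mul]
  rfl

variable [Fintype E] [DecidableEq κ]

lemma det_transpose_mul_diagonal_mul {R : Type*} [CommRing R] (B : Matrix E κ R) (y : E → R) :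
    (Bᵀ * diagonal y * B).det =
      ∑ T ∈ powersetCard (Fintype.card κ) univ, (∏ e ∈ T, y e) * gramMinor B T := by
  have h := coeff_det_one_add_X_smul_eq_sum_minors (Bᵀ * (diagonal y * B)) (Fintype.card κ)
  have h' := coeff_det_one_add_X_smul_eq_sum_minors (diagonal y * B * Bᵀ) (Fintype.card κ)
  rw [← card_univ, powersetCard_self, sum_singleton, card_univ] at h
  have hX : ((Polynomial.X : Polynomial R) • (Bᵀ * (diagonal y * B)).map Polynomial.C) =
      ((Polynomial.X : Polynomial R) • Bᵀ.map (Polynomial.C : R → Polynomial R)) *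
        (diagonal y * B).map Polynomial.C := by
    rw [Matrix.map_mul (f := (Polynomial.C : R →+* Polynomial R)), Matrix.smul_mul]
  rw [hX, det_one_add_mul_comm, Matrix.mul_smul,
    ← Matrix.map_mul (f := (Polynomial.C : R →+* Polynomial R)), h'] at h
  have h2 : ((Bᵀ * (diagonal y * B)).submatrix (Subtype.val : ↥(univ : Finset κ) → κ)
      Subtype.val).det = (Bᵀ * diagonal y * B).det := by
    rw [Matrix.mul_assoc]
    exact det_submatrix_equiv_self (Equiv.subtypeUnivEquiv mem_univ) _
  rw [← h2, ← h]
  refine sum_congr rfl fun T _ => ?_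
  have h3 : (diagonal y * B * Bᵀ).submatrix (Subtype.val : T → E) Subtype.val =
      of fun i j : T => y i * (B * Bᵀ).submatrix (Subtype.val : T → E) Subtype.val i j := by
    ext i j
    simp [Matrix.mul_assoc, diagonal_mul]
  rw [h3, det_mul_column (fun i : T => y i), gramMinor, prod_coe_sort T y]

lemma det_fromBlocks_diagonal_of_ne_zero {K : Type*} [Field K] (B : Matrix E κ K)
    {d : E → K} (hd : ∀ e, d e ≠ 0) :
    (fromBlocks (diagonal d) B Bᵀ 0).det = (-1) ^ Fintype.card κ *
      ∑ T ∈ powersetCard (Fintype.card κ) univ, (∏ e ∈ Tᶜ, d e) * gramMinor B T := by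
  have hu : IsUnit d := Pi.isUnit_iff.2 fun e => (hd e).isUnit
  have := hu.invertible
  have := diagonalInvertible d
  have hinv : ⅟(diagonal d) = diagonal fun e => (d e)⁻¹ := by
    refine invOf_eq_right_inv ?_
    rw [diagonal_mul_diagonal, ← diagonal_one]
    congr 1
    ext e
    simp [hd e]
  rw [det_fromBlocks₁₁, hinv, zero_sub, det_neg, det_transpose_mul_diagonal_mul, det_diagonal,
    mul_left_comm, mul_sum]
  congr 1
  refine sum_congr rfl fun T _ => ?_
  have h : (∏ e ∈ T, d e) * ∏ e ∈ T, (d e)⁻¹ = 1 := by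
    rw [← prod_mul_distrib]
    exact prod_eq_one fun e _ => mul_inv_cancel₀ (hd e)
  rw [← prod_mul_prod_compl T d]
  linear_combination (∏ e ∈ Tᶜ, d e) * gramMinor B T * h

/-- Expansion of the determinant of `[[diag d, B], [Bᵀ, 0]]` in the diagonal variables `d`. -/
lemma det_fromBlocks_diagonal {R : Type*} [CommRing R] [IsDomain R] (B : Matrix E κ R)
    (d : E → R) :
    (fromBlocks (diagonal d) B Bᵀ 0).det = (-1) ^ Fintype.card κ *
      ∑ T ∈ powersetCard (Fintype.card κ) univ, (∏ e ∈ Tᶜ, d e) * gramMinor B T := by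
  have key : (fromBlocks (diagonal MvPolynomial.X) (B.map MvPolynomial.C)
      (B.map MvPolynomial.C)ᵀ 0).det = (-1) ^ Fintype.card κ *
      ∑ T ∈ powersetCard (Fintype.card κ) univ, (∏ e ∈ Tᶜ, (MvPolynomial.X e)) *
        gramMinor (B.map (MvPolynomial.C : R →+* MvPolynomial E R)) T := by
    set ι := algebraMap (MvPolynomial E R) (FractionRing (MvPolynomial E R))
    have hι : Function.Injective ι := IsFractionRing.injective _ _
    apply hι
    have h := det_fromBlocks_diagonal_of_ne_zero
      ((B.map (MvPolynomial.C : R →+* MvPolynomial E R)).map ι)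
      (d := fun e => ι (MvPolynomial.X e))
      (fun e => (map_ne_zero_iff ι hι).2 (MvPolynomial.X_ne_zero e))
    simp only [gramMinor_map, ← map_prod, ← map_mul, ← map_sum] at h
    simp only [gramMinor_map]
    rw [RingHom.map_det, RingHom.mapMatrix_apply, fromBlocks_map, transpose_map, diagonal_map,
      Matrix.map_zero]
    · rw [map_mul, map_pow, map_neg, map_one, ← h]
    all_goals simp
  have h := congrArg (MvPolynomial.eval d) key
  simp only [gramMinor_map] at h
  rw [RingHom.map_det, RingHom.mapMatrix_apply, fromBlocks_map, transpose_map, diagonal_map,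
    Matrix.map_zero, Matrix.map_map] at h
  · convert! h using 2
    · congr 1
      · ext i j; simp [diagonal_apply]
      · ext; simp
      · ext; simp
    · simp
  all_goals simp

lemma adjugate_mul_adjugate_sub {n R : Type*} [Fintype n] [DecidableEq n] [CommRing R]
    (M : Matrix n n R) {i j : n} (hij : i ≠ j) :
    M.adjugate i i * M.adjugate j j - M.adjugate i j * M.adjugate j i =
      M.det * ((M.updateCol i (Pi.single i 1)).updateCol j (Pi.single j 1)).det := by
  let N := mvPolynomialX n n ℤ
  suffices h : N.adjugate i i * N.adjugate j j - N.adjugate i j * N.adjugate j i =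
      N.det * ((N.updateCol i (Pi.single i 1)).updateCol j (Pi.single j 1)).det by
    let φ := (MvPolynomial.aeval (R := ℤ) fun p : n × n => M p.1 p.2).toRingHom
    have hφ : N.map φ = M := mvPolynomialX_mapMatrix_aeval ℤ M
    have hadj (a b : n) : φ (N.adjugate a b) = M.adjugate a b := by
      rw [← hφ, ← RingHom.mapMatrix_apply, ← RingHom.map_adjugate]
      rfl
    have hcol (k : n) : φ ∘ Pi.single k 1 = Pi.single k 1 := by
      ext l
      simp [Pi.single_apply, apply_ite φ]
    have := congrArg φ h
    simpa only [map_sub, map_mul, hadj, RingHom.map_det, RingHom.mapMatrix_apply,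
      Matrix.map_updateCol, hφ, hcol] using this
  have hdet : N.det ≠ 0 := det_mvPolynomialX_ne_zero n ℤ
  have hcol (k : n) : N *ᵥ (fun l => N.adjugate l k) = N.det • Pi.single k 1 := by
    funext l
    have := congrFun (congrFun (mul_adjugate N) l) k
    simpa [mul_apply, mulVec, dotProduct, one_apply, Pi.single_apply] using this
  let W := ((1 : Matrix n n (MvPolynomial (n × n) ℤ)).updateCol i
    fun l => N.adjugate l i).updateCol j fun l => N.adjugate l j
  have hW : W.det = N.adjugate i i * N.adjugate j j - N.adjugate i j * N.adjugate j i := by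
    let U : Matrix n (Fin 2) (MvPolynomial (n × n) ℤ) := of fun l =>
      ![N.adjugate l i - if l = i then 1 else 0, N.adjugate l j - if l = j then 1 else 0]
    let V : Matrix (Fin 2) n (MvPolynomial (n × n) ℤ) :=
      (1 : Matrix n n (MvPolynomial (n × n) ℤ)).submatrix ![i, j] id
    have hU₀ (a : n) : U a 0 = N.adjugate a i - if a = i then 1 else 0 := rfl
    have hU₁ (a : n) : U a 1 = N.adjugate a j - if a = j then 1 else 0 := rfl
    have hVU (k l : Fin 2) : (V * U) k l = U (![i, j] k) l := by
      rw [mul_apply]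
      change ∑ x, (1 : Matrix n n _) (![i, j] k) x * U x l = _
      simp only [one_apply, ite_mul, one_mul, zero_mul, sum_ite_eq, mem_univ, if_true]
    have : W = 1 + U * V := by
      refine Matrix.ext fun a b => ?_
      rw [Matrix.add_apply, mul_apply, Fin.sum_univ_two, hU₀, hU₁]
      change _ = _ + (_ * (1 : Matrix n n _) i b + _ * (1 : Matrix n n _) j b)
      by_cases hb : b = j
      · subst hb
        simp [W, one_apply, hij]
      · by_cases hb' : b = i
        · subst hb'
          simp [W, one_apply, hij, hij.symm]
        · simp [W, hb, hb', Ne.symm hb, Ne.symm hb', one_apply]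
    rw [this, det_one_add_mul_comm, det_fin_two]
    simp only [Matrix.add_apply, hVU]
    simp [hU₀, hU₁, hij, hij.symm]
  have h := det_mul N W
  rw [hW, mul_updateCol, mul_updateCol, mul_one, hcol, hcol, det_updateCol_smul,
    updateCol_comm _ hij, det_updateCol_smul, updateCol_comm _ hij.symm] at h
  exact (mul_left_cancel₀ hdet h).symm

lemma updateCol_add_single {n R : Type*} [DecidableEq n] [CommRing R] (M : Matrix n n R) (i : n) :
    M.updateCol i ((fun l => M l i) + Pi.single i 1) = M + single i i 1 := by
  ext a b
  by_cases hb : b = i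
  · subst hb
    simp [single_apply, Pi.single_apply, eq_comm]
  · simp [hb, Ne.symm hb]

lemma det_add_single {n R : Type*} [Fintype n] [DecidableEq n] [CommRing R]
    (M : Matrix n n R) (i : n) :
    (M + single i i 1).det = M.det + (M.updateCol i (Pi.single i 1)).det := by
  rw [← updateCol_add_single, det_updateCol_add, updateCol_eq_self]

/-- For a symmetric matrix, the discriminant of the determinant in two diagonal entries is a
square. -/
lemma det_add_single_mul_sub {n R : Type*} [Fintype n] [DecidableEq n] [CommRing R]
    {M : Matrix n n R} (hM : M.IsSymm) {i j : n} (hij : i ≠ j) :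
    (M + single i i 1).det * (M + single j j 1).det -
      M.det * (M + single i i 1 + single j j 1).det = M.adjugate i j ^ 2 := by
  have h := adjugate_mul_adjugate_sub M hij
  rw [hM.adjugate.apply i j] at h
  have hi : ∀ k, (M.updateCol k (Pi.single k 1)).det = M.adjugate k k := fun k => by
    rw [adjugate_apply, ← det_transpose, ← updateRow_transpose, hM.eq]
  have hc : (M + single i i 1).updateCol j (Pi.single j 1) =
      (M.updateCol j (Pi.single j 1)) + single i i 1 := by
    ext a b
    by_cases hb : b = j
    · subst hb; simp [hij]
    · simp [hb]
  rw [det_add_single (M + single i i 1), hc, det_add_single, det_add_single, det_add_single,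
    updateCol_comm _ hij.symm, hi, hi]
  linear_combination h

end Determinants

section MinorSum

open Matrix Finset

variable {E : Type*} [Fintype E] [DecidableEq E]

/-- The basis generating polynomial `∑_T ∏_{e ∉ T} x e` over the family `𝓣`, after deleting `S` and
contracting `Z`. -/
def minorSum {R : Type*} [CommSemiring R] (𝓣 : Finset (Finset E)) (S Z : Finset E) (x : E → R) : R :=
  ∑ T ∈ 𝓣 with Disjoint S T ∧ Z ⊆ T, ∏ e ∈ (S ∪ T)ᶜ, x e

variable {𝓣 : Finset (Finset E)} {S Z : Finset E}

lemma minorSum_eq_add {R : Type*} [CommSemiring R] (x : E → R) {e : E} (he : e ∉ S) :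
    minorSum 𝓣 S Z x = x e * minorSum 𝓣 (insert e S) Z x + minorSum 𝓣 S (insert e Z) x := by
  simp only [minorSum, sum_filter, mul_sum, ← sum_add_distrib]
  refine sum_congr rfl fun T _ => ?_
  by_cases heT : e ∈ T
  · simp [heT, insert_subset_iff]
  · have h : (S ∪ T)ᶜ = insert e (insert e S ∪ T)ᶜ := by
      ext a
      by_cases ha : a = e
      · subst ha; simp [he, heT]
      · simp [ha]
    rw [h, prod_insert (by simp)]
    simp [heT, insert_subset_iff]

lemma minorSum_congr {R : Type*} [CommSemiring R] {x y : E → R}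
    (h : ∀ e, e ∉ S → e ∉ Z → x e = y e) : minorSum 𝓣 S Z x = minorSum 𝓣 S Z y := by
  refine sum_congr rfl fun T hT => prod_congr rfl fun e he => h e ?_ ?_
  all_goals simp only [mem_filter, mem_compl, mem_union, not_or] at hT he
  · exact he.1
  · exact fun h => he.2 (hT.2.2 h)

lemma map_minorSum {R R' : Type*} [CommSemiring R] [CommSemiring R'] (φ : R →+* R') (x : E → R) :
    φ (minorSum 𝓣 S Z x) = minorSum 𝓣 S Z (φ ∘ x) := by
  simp [minorSum, map_sum, map_prod]

lemma totalDegree_minorSum_le {σ K : Type*} [CommSemiring K] {r : ℕ} (h𝓣 : ∀ T ∈ 𝓣, #T = r)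
    {x : E → MvPolynomial σ K} (hx : ∀ e, (x e).totalDegree ≤ 1) :
    (minorSum 𝓣 S Z x).totalDegree ≤ Fintype.card E - (#S + r) := by
  refine MvPolynomial.totalDegree_finsetSum_le fun T hT => ?_
  simp only [mem_filter] at hT
  rw [← h𝓣 T hT.1, ← card_union_of_disjoint hT.2.1, ← card_compl]
  refine (MvPolynomial.totalDegree_finsetProd _ _).trans ?_
  exact (sum_le_card_nsmul _ _ 1 fun e _ => hx e).trans (by simp)

lemma minorSum_eq_zero {R : Type*} [CommSemiring R] {r : ℕ} (h𝓣 : ∀ T ∈ 𝓣, #T = r)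
    (h : Fintype.card E < #S + r) (x : E → R) : minorSum 𝓣 S Z x = 0 := by
  rw [minorSum, filter_eq_empty_iff.2, sum_empty]
  rintro T hT ⟨hd, -⟩
  have := card_le_univ (S ∪ T)
  rw [card_union_of_disjoint hd, h𝓣 T hT] at this
  omega

lemma minorSum_eq_of_card_le {R : Type*} [CommSemiring R] {r : ℕ} (h𝓣 : ∀ T ∈ 𝓣, #T = r)
    (h : Fintype.card E ≤ #S + r) (x y : E → R) : minorSum 𝓣 S Z x = minorSum 𝓣 S Z y := by
  refine sum_congr rfl fun T hT => ?_
  simp only [mem_filter] at hT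
  have : (S ∪ T)ᶜ = ∅ := by
    rw [← card_eq_zero, card_compl, card_union_of_disjoint hT.2.1, h𝓣 T hT.1]
    omega
  rw [this, prod_empty, prod_empty]

lemma minorSum_update {R : Type*} [CommSemiring R] (x : E → R) {e : E} (he : e ∉ S) (t : R) :
    minorSum 𝓣 S Z (Function.update x e t) =
      t * minorSum 𝓣 (insert e S) Z x + minorSum 𝓣 S (insert e Z) x := by
  rw [minorSum_eq_add _ he, Function.update_self,
    minorSum_congr (S := insert e S) (y := x), minorSum_congr (Z := insert e Z) (y := x)]
  all_goals
    intro g h1 h2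
    exact Function.update_of_ne (by rintro rfl; simp at h1 h2) _ _

variable {κ : Type*} [Fintype κ] [DecidableEq κ]

lemma det_fromBlocks_eq_minorSum {R : Type*} [CommRing R] [IsDomain R] {B : Matrix E κ ℤ}
    (h𝓣 : ∀ T ∈ 𝓣, #T = Fintype.card κ)
    (hB : ∀ T : Finset E, #T = Fintype.card κ → gramMinor B T = if T ∈ 𝓣 then 1 else 0)
    (S : Finset E) (d : E → R) :
    let B' : Matrix E κ R := of fun a k => if a ∈ S then 0 else (B a k : R)
    (fromBlocks (diagonal fun a => if a ∈ S then 1 else d a) B' B'ᵀ 0).det =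
      (-1) ^ Fintype.card κ * minorSum 𝓣 S ∅ d := by
  intro B'
  rw [det_fromBlocks_diagonal, minorSum]
  have hfilter : 𝓣.filter (fun T => Disjoint S T ∧ ∅ ⊆ T) =
      (powersetCard (Fintype.card κ) univ).filter fun T => T ∈ 𝓣 ∧ Disjoint S T := by
    ext T
    simp only [mem_filter, mem_powersetCard, subset_univ, true_and, empty_subset, and_true]
    exact ⟨fun h => ⟨h𝓣 T h.1, h⟩, And.right⟩
  rw [hfilter, sum_filter]
  congr 1
  refine sum_congr rfl fun T hT => ?_
  by_cases hd : Disjoint S T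
  · have hminor : gramMinor B' T = if T ∈ 𝓣 then 1 else 0 := by
      have : ∀ a ∈ T, B' a = B.map (Int.castRingHom R) a := fun a ha => by
        ext k
        simp [B', disjoint_right.1 hd ha]
      rw [gramMinor_congr this, gramMinor_map, hB T (mem_powersetCard.1 hT).2]
      split_ifs <;> simp
    have hprod : ∏ a ∈ Tᶜ, (if a ∈ S then 1 else d a) = ∏ a ∈ (S ∪ T)ᶜ, d a := by
      refine (prod_subset_one_on_sdiff (compl_subset_compl.2 subset_union_right)
        (fun a ha => ?_) fun a ha => ?_).symm
      · have : a ∈ S := by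
          simp only [mem_sdiff, mem_compl, mem_union] at ha
          tauto
        simp [this]
      · simp_all
    rw [hminor, hprod]
    simp [hd]
  · obtain ⟨a, haS, haT⟩ := not_disjoint_iff.1 hd
    rw [gramMinor_eq_zero_of_row haT (by ext k; simp [B', haS])]
    simp [hd]

/-- Dodgson-type identity: the discriminant of the generating polynomial in two variables is a
square. -/
lemma exists_minorSum_discr_eq_sq {R : Type*} [CommRing R] [IsDomain R] {B : Matrix E κ ℤ}
    (h𝓣 : ∀ T ∈ 𝓣, #T = Fintype.card κ)
    (hB : ∀ T : Finset E, #T = Fintype.card κ → gramMinor B T = if T ∈ 𝓣 then 1 else 0)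
    {e f : E} (he : e ∉ S) (hf : f ∉ S) (hef : e ≠ f) (x : E → R) :
    ∃ D : R, minorSum 𝓣 (insert e S) {f} x * minorSum 𝓣 (insert f S) {e} x -
      minorSum 𝓣 (insert f (insert e S)) ∅ x * minorSum 𝓣 S {f, e} x = D ^ 2 := by
  set a := minorSum 𝓣 (insert f (insert e S)) ∅ x
  set b := minorSum 𝓣 (insert e S) {f} x
  set c := minorSum 𝓣 (insert f S) {e} x
  set d := minorSum 𝓣 S {f, e} x
  let B' : Matrix E κ R := of fun a k => if a ∈ S then 0 else (B a k : R)
  let y (s t : R) : E → R := fun a => if a = e then s else if a = f then t else x a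
  let M (s t : R) := fromBlocks (diagonal fun a => if a ∈ S then 1 else y s t a) B' B'ᵀ 0
  have hye (s t : R) : y s t e = s := by simp [y]
  have hyf (s t : R) : y s t f = t := by simp [y, hef.symm]
  have hyx (s t : R) (g : E) (h1 : g ≠ e) (h2 : g ≠ f) : y s t g = x g := by simp [y, h1, h2]
  have hms {s t : R} (S' Z' : Finset E) (h1 : e ∈ S' ∪ Z') (h2 : f ∈ S' ∪ Z') :
      minorSum 𝓣 S' Z' (y s t) = minorSum 𝓣 S' Z' x := by
    refine minorSum_congr fun g hg hg' => hyx s t g ?_ ?_ <;> rintro rfl <;> simp_all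
  have hM (s t : R) : (M s t).det =
      (-1) ^ Fintype.card κ * (s * (t * a + b) + (t * c + d)) := by
    rw [det_fromBlocks_eq_minorSum h𝓣 hB, minorSum_eq_add _ he,
      minorSum_eq_add _ (e := f) (S := insert e S) (by simp [hf, hef.symm]),
      minorSum_eq_add _ (e := f) (S := S) hf, hye, hyf]
    rw [hms _ _ (by simp) (by simp), hms _ _ (by simp) (by simp), hms _ _ (by simp) (by simp),
      hms _ _ (by simp) (by simp)]
    rfl
  have hinl (s t : R) : M s t + single (Sum.inl e) (Sum.inl e) 1 = M (s + 1) t := by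
    ext (i | i) (j | j)
    · by_cases hij : i = j
      · subst hij
        by_cases hi : i = e
        · subst hi
          simp [M, hye, he]
        · simp [M, y, hi, Ne.symm hi]
      · simp only [M, Matrix.add_apply, fromBlocks_apply₁₁, diagonal_apply, hij, if_false]
        rw [single_apply, if_neg (by grind)]
        simp
    all_goals simp [M]
  have hinr (s t : R) : M s t + single (Sum.inl f) (Sum.inl f) 1 = M s (t + 1) := by
    ext (i | i) (j | j)
    · by_cases hij : i = j
      · subst hij
        by_cases hi : i = f
        · subst hi
          simp [M, hyf, hf]
        · simp [M, y, hi, Ne.symm hi]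
      · simp only [M, Matrix.add_apply, fromBlocks_apply₁₁, diagonal_apply, hij, if_false]
        rw [single_apply, if_neg (by grind)]
        simp
    all_goals simp [M]
  have hsymm : (M 0 0).IsSymm := by
    simp [M, IsSymm, fromBlocks_transpose]
  have h := det_add_single_mul_sub hsymm (i := Sum.inl e) (j := Sum.inl f) (by simpa using hef)
  rw [hinl, hinr, hinr, hM, hM, hM, hM] at h
  refine ⟨_, Eq.trans ?_ h⟩
  have hsign : ((-1 : R) ^ Fintype.card κ) ^ 2 = 1 := by
    rw [← pow_mul, mul_comm, pow_mul]
    simp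
  linear_combination -(b * c - a * d) * hsign

end MinorSum

section Counting

open Finset Function

variable {E : Type*} [Fintype E] [DecidableEq E]

lemma card_mul_card_filter_eq_sum {K : Type*} [Fintype K] (A : (E → K) → Prop)
    [DecidablePred A] (e : E) :
    Fintype.card K * #{x | A x} = ∑ x : E → K, #{t | A (update x e t)} := by
  have h : ∑ z : (E → K) × K, (if A (update z.1 e z.2) then 1 else 0) =
      ∑ z : (E → K) × K, if A z.1 then 1 else 0 := by
    have hinv : Involutive fun z : (E → K) × K => (update z.1 e z.2, z.1 e) := fun z => by simp
    exact Fintype.sum_bijective _ hinv.bijective _ _ fun z => rfl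
  simp only [Fintype.sum_prod_type] at h
  simp only [card_filter]
  rw [h, mul_sum]
  exact sum_congr rfl fun x _ => by split_ifs <;> simp

lemma card_filter_eq_pow_mul {K : Type*} [Fintype K] [Zero K] (S : Finset E) (A : (E → K) → Prop)
    [DecidablePred A] (hA : ∀ x y : E → K, (∀ e ∉ S, x e = y e) → (A x ↔ A y)) :
    #{x | A x} = Fintype.card K ^ #S *
      #{y : {e // e ∉ S} → K | A fun e => if h : e ∈ S then 0 else y ⟨e, h⟩} := by
  have h := card_equiv (s := ({x | A x} : Finset (E → K)))
    (t := (univ : Finset ({e // e ∈ S} → K)) ×ˢ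
      ({y | A fun e => if h : e ∈ S then 0 else y ⟨e, h⟩} : Finset ({e // e ∉ S} → K)))
    (Equiv.piEquivPiSubtypeProd (fun e => e ∈ S) fun _ => K) fun x => by
      simp only [mem_filter, mem_univ, true_and, mem_product]
      exact hA _ _ fun e he => by simp [he]
  rw [h, card_product]
  simp

lemma card_linear_system {K : Type*} [Field K] [Fintype K] [DecidableEq K] (a b c d : K) :
    (#{t | t * a + b = 0 ∧ t * c + d = 0} : ℤ) = (if b * c - a * d = 0 then 1 else 0) -
      (if a = 0 ∧ c = 0 then 1 else 0) +
        Fintype.card K * if a = 0 ∧ b = 0 ∧ c = 0 ∧ d = 0 then 1 else 0 := by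
  by_cases hac : a = 0 ∧ c = 0
  · obtain ⟨rfl, rfl⟩ := hac
    by_cases hbd : b = 0 ∧ d = 0 <;> simp [hbd]
  · have h4 : ¬ (a = 0 ∧ b = 0 ∧ c = 0 ∧ d = 0) := fun h => hac ⟨h.1, h.2.2.1⟩
    by_cases hdisc : b * c - a * d = 0
    · have : ∃ s, ∀ t, (t * a + b = 0 ∧ t * c + d = 0) ↔ t = s := by
        by_cases ha : a = 0
        · have hc : c ≠ 0 := fun hc => hac ⟨ha, hc⟩
          have hb : b = 0 := by simpa [ha, hc] using hdisc
          refine ⟨-d / c, fun t => ?_⟩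
          rw [ha, hb, eq_div_iff hc]
          simp [eq_neg_iff_add_eq_zero]
        · refine ⟨-b / a, fun t => ?_⟩
          rw [eq_div_iff ha, eq_neg_iff_add_eq_zero, and_iff_left_iff_imp]
          intro h
          refine (mul_eq_zero.1 ?_).resolve_left ha
          linear_combination c * h - hdisc
      obtain ⟨s, hs⟩ := this
      simp [hs, hdisc, hac, h4, filter_eq']
    · have : ∀ t, ¬ (t * a + b = 0 ∧ t * c + d = 0) := fun t ht => hdisc (by
        linear_combination c * ht.1 - a * ht.2)
      simp [this, hdisc, hac, h4]

variable {p : ℕ} [Fact p.Prime] {𝓣 : Finset (Finset E)} {S : Finset E} {κ : Type*} [Fintype κ]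
  [DecidableEq κ] {B : Matrix E κ ℤ}

lemma pow_dvd_card_discr (h𝓣 : ∀ T ∈ 𝓣, #T = Fintype.card κ)
    (hB : ∀ T : Finset E, #T = Fintype.card κ → gramMinor B T = if T ∈ 𝓣 then 1 else 0)
    (hκ : 2 ≤ Fintype.card κ) {e f : E} (he : e ∉ S) (hf : f ∉ S) (hef : e ≠ f)
    (hS : #S + 3 ≤ Fintype.card E) :
    p ^ (#S + 3) ∣ #{x : E → ZMod p |
      minorSum 𝓣 (insert e S) {f} x * minorSum 𝓣 (insert f S) {e} x -
        minorSum 𝓣 (insert f (insert e S)) ∅ x * minorSum 𝓣 S {f, e} x = 0} := by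
  have hcard : #(insert f (insert e S)) = #S + 2 := by
    rw [card_insert_of_notMem (by simp [hf, hef.symm]), card_insert_of_notMem he]
  rw [card_filter_eq_pow_mul (insert f (insert e S)), hcard, ZMod.card,
    show #S + 3 = #S + 2 + 1 from rfl, pow_succ]
  · refine mul_dvd_mul_left _ ?_
    let X' : E → MvPolynomial {a // a ∉ insert f (insert e S)} (ZMod p) :=
      fun a => if h : a ∈ insert f (insert e S) then 0 else MvPolynomial.X ⟨a, h⟩
    have hX' (a : E) : (X' a).totalDegree ≤ 1 := by
      by_cases h : a ∈ insert f (insert e S)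
      · simp only [X', dif_pos h, MvPolynomial.totalDegree_zero, zero_le]
      · simp only [X', dif_neg h, MvPolynomial.totalDegree_X, le_refl]
    obtain ⟨D, hD⟩ := exists_minorSum_discr_eq_sq h𝓣 hB he hf hef X'
    have hdeg : D.totalDegree < Fintype.card {a // a ∉ insert f (insert e S)} := by
      rw [Fintype.card_subtype_compl, Fintype.card_coe, hcard]
      by_cases hD0 : D = 0
      · rw [hD0, MvPolynomial.totalDegree_zero]
        omega
      have he' := card_insert_of_notMem he
      have hf' := card_insert_of_notMem hf
      have hdeg (S' Z' : Finset E) :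
          (minorSum 𝓣 S' Z' X').totalDegree ≤ Fintype.card E - (#S' + Fintype.card κ) :=
        totalDegree_minorSum_le h𝓣 hX'
      have h₁ : (minorSum 𝓣 (insert e S) {f} X' * minorSum 𝓣 (insert f S) {e} X').totalDegree ≤
          2 * (Fintype.card E - (#S + 1 + Fintype.card κ)) := by
        refine (MvPolynomial.totalDegree_mul _ _).trans ?_
        have := hdeg (insert e S) {f}
        have := hdeg (insert f S) {e}
        omega
      have h₂ : (minorSum 𝓣 (insert f (insert e S)) ∅ X' *
          minorSum 𝓣 S {f, e} X').totalDegree ≤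
          2 * (Fintype.card E - (#S + 1 + Fintype.card κ)) := by
        by_cases h : Fintype.card E < #S + 2 + Fintype.card κ
        · rw [minorSum_eq_zero h𝓣 (by omega), zero_mul, MvPolynomial.totalDegree_zero]
          exact zero_le
        · refine (MvPolynomial.totalDegree_mul _ _).trans ?_
          have := hdeg (insert f (insert e S)) ∅
          have := hdeg S {f, e}
          omega
      have h := (MvPolynomial.totalDegree_sub _ _).trans (max_le h₁ h₂)
      rw [hD, pow_two, MvPolynomial.totalDegree_mul_of_isDomain hD0 hD0] at h
      omega
    have heval (y : {a // a ∉ insert f (insert e S)} → ZMod p) :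
        MvPolynomial.eval y ∘ X' =
          fun a => if h : a ∈ insert f (insert e S) then 0 else y ⟨a, h⟩ := by
      ext a
      by_cases h : a ∈ insert f (insert e S)
      · simp only [X', comp_apply, dif_pos h, map_zero]
      · simp only [X', comp_apply, dif_neg h, MvPolynomial.eval_X]
    have := char_dvd_card_solutions p hdeg
    rw [Fintype.card_subtype] at this
    convert! this using 3 with y
    rw [← heval, ← pow_eq_zero_iff (a := MvPolynomial.eval y D) two_ne_zero, ← map_pow,
      ← hD, map_sub, map_mul, map_mul]
    simp only [map_minorSum]
  · intro x y h
    rw [minorSum_congr, minorSum_congr (S := insert f S),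
      minorSum_congr (S := insert f (insert e S)), minorSum_congr (S := S)]
    all_goals
      intro g h1 h2
      exact h g (by simp_all)

lemma pow_dvd_card_minorSum_eq_zero_and (h𝓣 : ∀ T ∈ 𝓣, #T = Fintype.card κ)
    (hB : ∀ T : Finset E, #T = Fintype.card κ → gramMinor B T = if T ∈ 𝓣 then 1 else 0)
    (hκ : 2 ≤ Fintype.card κ) {e : E} (he : e ∉ S) (hS : #S + 2 ≤ Fintype.card E) :
    p ^ (#S + 2) ∣
      #{x : E → ZMod p | minorSum 𝓣 (insert e S) ∅ x = 0 ∧ minorSum 𝓣 S {e} x = 0} := by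
  induction hn : Fintype.card E - #S generalizing S with
  | zero => omega
  | succ n ih =>
  obtain hS' | hS' := hS.eq_or_lt
  · have hc (x : E → ZMod p) : minorSum 𝓣 S {e} x = minorSum 𝓣 S {e} 0 :=
      minorSum_eq_of_card_le h𝓣 (by omega) _ _
    have h0 (x : E → ZMod p) : minorSum 𝓣 (insert e S) ∅ x = 0 :=
      minorSum_eq_zero h𝓣 (by rw [card_insert_of_notMem he]; omega) x
    simp only [h0, hc, true_and, filter_const]
    split_ifs
    · simp [hS']
    · simp
  · obtain ⟨f, hf⟩ : ∃ f, f ∉ insert e S := by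
      by_contra! h
      have := card_insert_of_notMem he
      rw [eq_univ_iff_forall.2 h, card_univ] at this
      omega
    obtain ⟨hfe, hf⟩ : f ≠ e ∧ f ∉ S := by simpa using hf
    have hW : p ^ (#S + 2) ∣ #{x : E → ZMod p | minorSum 𝓣 (insert f (insert e S)) ∅ x = 0 ∧
        minorSum 𝓣 (insert e S) {f} x = 0 ∧ minorSum 𝓣 (insert f S) {e} x = 0 ∧
        minorSum 𝓣 S {f, e} x = 0} := by
      rw [card_filter_eq_pow_mul (insert f (insert e S)), ZMod.card,
        card_insert_of_notMem (by simp [hf, hfe]), card_insert_of_notMem he]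
      · exact dvd_mul_right _ _
      · intro x y h
        rw [minorSum_congr, minorSum_congr (S := insert e S), minorSum_congr (S := insert f S),
          minorSum_congr (S := S)]
        all_goals
          intro g h1 h2
          exact h g (by simp_all)
    have hdiscr := pow_dvd_card_discr (p := p) h𝓣 hB hκ he hf hfe.symm hS'
    have hcard := card_insert_of_notMem hf
    have ih := ih (S := insert f S) (by simp [he, hfe.symm]) (by omega) (by omega)
    rw [hcard, insert_comm] at ih
    have hU := card_mul_card_filter_eq_sum
      (fun x : E → ZMod p => minorSum 𝓣 (insert e S) ∅ x = 0 ∧ minorSum 𝓣 S {e} x = 0) f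
    have hterm (x : E → ZMod p) (t : ZMod p) :
        (minorSum 𝓣 (insert e S) ∅ (update x f t) = 0 ∧ minorSum 𝓣 S {e} (update x f t) = 0) ↔
        (t * minorSum 𝓣 (insert f (insert e S)) ∅ x + minorSum 𝓣 (insert e S) {f} x = 0 ∧
          t * minorSum 𝓣 (insert f S) {e} x + minorSum 𝓣 S {f, e} x = 0) := by
      rw [minorSum_update x (by simp [hf, hfe]), minorSum_update x hf]
      rfl
    simp only [hterm, ZMod.card] at hU
    zify at hU hdiscr hW ih ⊢
    simp only [card_linear_system, sum_add_distrib, sum_sub_distrib, ← mul_sum, sum_boole,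
      ZMod.card] at hU
    refine (mul_dvd_mul_iff_left (a := (p : ℤ)) (by simpa using (Fact.out : p.Prime).ne_zero)).1 ?_
    rw [hU, ← pow_succ']
    refine dvd_add (dvd_sub hdiscr ih) ?_
    rw [pow_succ']
    exact mul_dvd_mul_left _ hW

/-- The generating polynomial of the bases of a regular matroid of rank at least two, with the
elements of `S` deleted, has a number of zeros divisible by `p ^ (#S + 2)`. -/
lemma pow_dvd_card_minorSum_eq_zero (h𝓣 : ∀ T ∈ 𝓣, #T = Fintype.card κ)
    (hB : ∀ T : Finset E, #T = Fintype.card κ → gramMinor B T = if T ∈ 𝓣 then 1 else 0)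
    (hκ : 2 ≤ Fintype.card κ) (hS : #S + 2 ≤ Fintype.card E) :
    p ^ (#S + 2) ∣ #{x : E → ZMod p | minorSum 𝓣 S ∅ x = 0} := by
  induction hn : Fintype.card E - #S generalizing S with
  | zero => omega
  | succ n ih =>
  obtain hS' | hS' := hS.eq_or_lt
  · have hc (x : E → ZMod p) : minorSum 𝓣 S ∅ x = minorSum 𝓣 S ∅ 0 :=
      minorSum_eq_of_card_le h𝓣 (by omega) _ _
    simp only [hc, filter_const]
    split_ifs
    · simp [hS']
    · simp
  · obtain ⟨e, he⟩ : ∃ e, e ∉ S := by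
      by_contra! h
      rw [eq_univ_iff_forall.2 h, card_univ] at hS'
      omega
    have hcard := card_insert_of_notMem he
    have ih := ih (S := insert e S) (by omega) (by omega)
    rw [hcard] at ih
    have hU := pow_dvd_card_minorSum_eq_zero_and (p := p) h𝓣 hB hκ he hS
    have hV := card_mul_card_filter_eq_sum (fun x : E → ZMod p => minorSum 𝓣 S ∅ x = 0) e
    have hlin (a b : ZMod p) : (#{t | t * a + b = 0} : ℤ) = 1 - (if a = 0 then 1 else 0) +
        p * if a = 0 ∧ b = 0 then 1 else 0 := by
      simpa using card_linear_system a b 0 0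
    simp only [minorSum_update _ he, ZMod.card] at hV
    zify at hU hV ih ⊢
    simp only [hlin, sum_add_distrib, sum_sub_distrib, ← mul_sum, sum_boole] at hV
    refine (mul_dvd_mul_iff_left (a := (p : ℤ)) (by simpa using (Fact.out : p.Prime).ne_zero)).1 ?_
    rw [hV, ← pow_succ']
    refine dvd_add (dvd_sub ?_ ih) ?_
    · simpa using pow_dvd_pow (p : ℤ) (by omega)
    · rw [pow_succ']
      exact mul_dvd_mul_left _ hU

end Counting

section Incidence

open Matrix Finset

variable {V : Type} {G : SimpleGraph V}

/-- The oriented incidence matrix of `G`, without the column of the vertex `r`. -/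
noncomputable def incidence (G : SimpleGraph V) (r : V) : Matrix G.edgeSet {v // v ≠ r} ℤ :=
  of fun e v => (if (v : V) = (e : Sym2 V).out.1 then 1 else 0) -
    if (v : V) = (e : Sym2 V).out.2 then 1 else 0

lemma out_fst_eq_iff {R : Type*} {θ : V → R} {u v : V} :
    θ (s(u, v) : Sym2 V).out.1 = θ (s(u, v) : Sym2 V).out.2 ↔ θ u = θ v := by
  have h : s((s(u, v) : Sym2 V).out.1, (s(u, v) : Sym2 V).out.2) = s(u, v) := Quot.out_eq _
  rcases Sym2.eq_iff.1 h with ⟨h₁, h₂⟩ | ⟨h₁, h₂⟩ <;> rw [h₁, h₂]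
  exact eq_comm

lemma edgeSet_fromEdgeSet_image (T : Finset G.edgeSet) :
    (fromEdgeSet (Subtype.val '' (T : Set G.edgeSet))).edgeSet =
      Subtype.val '' (T : Set G.edgeSet) := by
  rw [edgeSet_fromEdgeSet, sdiff_eq_left, Set.disjoint_left]
  rintro _ ⟨e, -, rfl⟩ he
  exact G.not_isDiag_of_mem_edgeSet e.2 he

/-- A potential is constant along the edges in `T` iff it is constant on the components of `T`. -/
lemma forall_mem_out_eq_iff {T : Finset G.edgeSet} {R : Type*} {θ : V → R} :
    (∀ e ∈ T, θ (e : Sym2 V).out.1 = θ (e : Sym2 V).out.2) ↔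
      ∀ u v, (fromEdgeSet (Subtype.val '' (T : Set G.edgeSet))).Reachable u v → θ u = θ v := by
  refine ⟨fun h u v hw => ?_, fun h ⟨e, he⟩ heT => ?_⟩
  · obtain ⟨w⟩ := hw
    induction w with
    | nil => rfl
    | cons hadj _ ih =>
      obtain ⟨⟨e, heT, he⟩, -⟩ := (fromEdgeSet_adj _).1 hadj
      have := h e heT
      rw [he, out_fst_eq_iff] at this
      exact this.trans ih
  · induction e using Sym2.ind with
    | _ u v =>
      refine out_fst_eq_iff.2 (h u v (Adj.reachable ?_))
      exact (fromEdgeSet_adj _).2 ⟨⟨⟨_, he⟩, heT, rfl⟩, G.ne_of_adj he⟩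

variable [Fintype V]

lemma card_ne_add_one (r : V) : Fintype.card {v // v ≠ r} + 1 = Fintype.card V := by
  have := Fintype.card_pos_iff.2 ⟨r⟩
  rw [Fintype.card_subtype_compl, Fintype.card_subtype_eq]
  omega

/-- The spanning trees of `G`, as sets of elements of `G.edgeSet`. -/
noncomputable def spanningTrees (G : SimpleGraph V) : Finset (Finset G.edgeSet) :=
  {T | IsSpanningTree G (Subtype.val '' (T : Set G.edgeSet))}

lemma incidence_mulVec {R : Type*} [CommRing R] {r : V} {θ : V → R} (hθ : θ r = 0)
    (e : G.edgeSet) : ((incidence G r).map (Int.castRingHom R) *ᵥ fun v => θ v) e =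
      θ (e : Sym2 V).out.1 - θ (e : Sym2 V).out.2 := by
  have h (w : V) : ∑ v : {v // v ≠ r}, (if (v : V) = w then θ v else 0) = θ w := by
    by_cases hw : w = r
    · subst hw
      rw [hθ]
      exact sum_eq_zero fun v _ => if_neg v.2
    · rw [Fintype.sum_eq_single ⟨w, hw⟩, if_pos rfl]
      exact fun v hv => if_neg fun h => hv (Subtype.ext h)
  simp only [mulVec, dotProduct, incidence, map_apply, of_apply, map_sub, sub_mul, sum_sub_distrib]
  rw [← h, ← h (e : Sym2 V).out.2]
  simp

lemma mem_spanningTrees_iff {T : Finset G.edgeSet} : T ∈ spanningTrees G ↔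
    (fromEdgeSet (Subtype.val '' (T : Set G.edgeSet))).Connected ∧ #T + 1 = Fintype.card V := by
  have hcard : Nat.card (fromEdgeSet (Subtype.val '' (T : Set G.edgeSet))).edgeSet = #T := by
    rw [edgeSet_fromEdgeSet_image, Nat.card_image_of_injective Subtype.val_injective]
    simp
  rw [spanningTrees, mem_filter, IsSpanningTree, ← hcard, ← Nat.card_eq_fintype_card,
    ← isTree_iff_connected_and_card, isTree_iff]
  simp

lemma gramMinor_incidence (r : V) {T : Finset G.edgeSet}
    (hT : #T = Fintype.card {v // v ≠ r}) :
    gramMinor (incidence G r) T = if T ∈ spanningTrees G then 1 else 0 := by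
  let σ : {v // v ≠ r} ≃ T := Fintype.equivOfCardEq (by rw [Fintype.card_coe, hT])
  rw [gramMinor_eq_det_sq _ _ σ]
  simp only [mem_spanningTrees_iff, hT, card_ne_add_one, and_true]
  set C := (incidence G r).submatrix (fun k => (σ k : G.edgeSet)) id
  have hmul {R : Type} [CommRing R] {θ : V → R} (hθ : θ r = 0) :
      C.map (Int.castRingHom R) *ᵥ (fun v => θ v) = 0 ↔
      ∀ u v, (fromEdgeSet (Subtype.val '' (T : Set G.edgeSet))).Reachable u v → θ u = θ v := by
    have h (k : {v // v ≠ r}) : (C.map (Int.castRingHom R) *ᵥ fun v => θ v) k =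
        θ ((σ k : G.edgeSet) : Sym2 V).out.1 - θ ((σ k : G.edgeSet) : Sym2 V).out.2 :=
      incidence_mulVec hθ _
    simp only [← forall_mem_out_eq_iff, funext_iff, h, Pi.zero_apply, sub_eq_zero]
    exact (σ.forall_congr_right (q := fun e : T =>
      θ ((e : G.edgeSet) : Sym2 V).out.1 = θ ((e : G.edgeSet) : Sym2 V).out.2)).trans Subtype.forall
  split_ifs with hconn
  · have hunit : C.det.natAbs = 1 := by
      by_contra hne
      obtain ⟨q, hq, hdvd⟩ := Nat.exists_prime_and_dvd hne
      have : Fact q.Prime := ⟨hq⟩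
      have h0 : (C.map (Int.castRingHom (ZMod q))).det = 0 := by
        rw [← RingHom.mapMatrix_apply, ← RingHom.map_det, eq_intCast,
          ZMod.intCast_zmod_eq_zero_iff_dvd]
        exact Int.natCast_dvd.2 hdvd
      obtain ⟨y, hy, hCy⟩ := exists_mulVec_eq_zero_iff.2 h0
      let θ : V → ZMod q := fun v => if h : v = r then 0 else y ⟨v, h⟩
      have hθy : (fun v : {v // v ≠ r} => θ v) = y := by
        ext v
        simp [θ, v.2]
      have hθ : θ r = 0 := by simp [θ]
      rw [← hθy, hmul hθ] at hCy
      refine hy ?_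
      rw [← hθy]
      ext v
      rw [hCy _ _ (hconn.preconnected v r), hθ]
      rfl
    rw [← sq_abs, Int.abs_eq_natAbs, hunit]
    simp
  · obtain ⟨w, hw⟩ : ∃ w, ¬ (fromEdgeSet (Subtype.val '' (T : Set G.edgeSet))).Reachable w r := by
      by_contra! h
      exact hconn ((connected_iff_exists_forall_reachable _).2 ⟨r, fun w => (h w).symm⟩)
    let θ : V → ℤ := fun v =>
      if (fromEdgeSet (Subtype.val '' (T : Set G.edgeSet))).Reachable w v then 1 else 0
    have hθ : θ r = 0 := if_neg hw
    have hCθ := (hmul hθ).2 fun u v h => by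
      have : (fromEdgeSet (Subtype.val '' (T : Set G.edgeSet))).Reachable w u ↔
          (fromEdgeSet (Subtype.val '' (T : Set G.edgeSet))).Reachable w v :=
        ⟨fun hu => hu.trans h, fun hv => hv.trans h.symm⟩
      simp only [θ, this]
    have hdet : C.det = 0 := exists_mulVec_eq_zero_iff.1 ⟨fun v => θ v, fun h => by
      have := congrFun h ⟨w, fun h => hw (h ▸ Reachable.refl _)⟩
      simp [θ] at this, by simpa using hCθ⟩
    rw [hdet]
    simp

lemma zeroCount_eq_card (p : ℕ) [Fact p.Prime] : zeroCount G p =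
    #{x : G.edgeSet → ZMod p | minorSum (spanningTrees G) ∅ ∅ x = 0} := by
  rw [zeroCount, Nat.card_eq_fintype_card, Fintype.card_subtype]
  congr! 4 with x
  rw [kirchhoff, minorSum, map_sum, map_sum]
  symm
  refine sum_bij (fun T _ => T.map (Function.Embedding.subtype _)) ?_ ?_ ?_ ?_
  · intro T hT
    simp only [spanningTrees, mem_filter, mem_univ, true_and] at hT
    simp only [mem_filter, mem_powerset, coe_map]
    exact ⟨fun e he => by
      obtain ⟨e, -, rfl⟩ := mem_map.1 he
      exact mem_edgeFinset.2 e.2, hT.1⟩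
  · intro T _ T' _ h
    exact map_injective _ h
  · intro T hT
    simp only [mem_filter, mem_powerset] at hT
    have hmap : (T.subtype (· ∈ G.edgeSet)).map (Function.Embedding.subtype _) = T :=
      subtype_map_of_mem fun e he => mem_edgeFinset.1 (hT.1 he)
    refine ⟨T.subtype (· ∈ G.edgeSet), ?_, hmap⟩
    simp only [spanningTrees, mem_filter, mem_univ, true_and, empty_subset, disjoint_empty_left,
      and_true]
    rw [← hmap, coe_map] at hT
    exact hT.2
  · intro T _
    rw [map_prod, map_prod]
    refine prod_subset_one_on_sdiff (subset_univ _) (fun e he => ?_) fun e he => ?_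
    · have : e ∈ T := by simpa using he
      simp [this]
    · have : e ∉ T := by simpa using he
      simp [this]

end Incidence

/-- For a connected graph with at least three vertices, `p²` divides `[Ψ_G]_p`; this is
the fact that the `c₂` invariant `c₂^{(p)}(G) = [Ψ_G]_p / p² mod p` is well defined. -/
theorem sq_dvd_zeroCount {V : Type} [Fintype V] (G : SimpleGraph V)
    (hG : G.Connected) (hV : 3 ≤ Fintype.card V) (p : ℕ) (hp : p.Prime) :
    p ^ 2 ∣ zeroCount G p := by
  have := Fact.mk hp
  obtain ⟨r⟩ := hG.nonempty
  have hV' := card_ne_add_one r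
  have hE := hG.card_vert_le_card_edgeSet_add_one
  rw [Nat.card_eq_fintype_card, Nat.card_eq_fintype_card] at hE
  rw [zeroCount_eq_card]
  exact pow_dvd_card_minorSum_eq_zero (S := ∅) (B := incidence G r)
    (fun T hT => by have := (mem_spanningTrees_iff.1 hT).2; omega)
    (fun T hT => gramMinor_incidence r hT) (by omega) (by rw [Finset.card_empty]; omega)
end

section
/- Let G be a finite simple graph, let P = {P₁, …, P_j} be a collection of pairwise disjoint nonempty subsets of V(G), and let e = {u, v} be an edge of G whose two endpoints u and v both lie in the same part P_i. Then the spanning forest polynomial satisfies the deletion–contraction identity Φ_G^P = α_e · Φ_{G∖e}^P + Σ_{(A,B)} Φ_{G∖e}^{(P∖{P_i}) ∪ {A, B}}, where the sum is over all ways of splitting P_i into two disjoint nonempty sets A and B with P_i = A ∪ B, u ∈ A and v ∈ B, and G∖e denotes G with the edge e deleted. -/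
open SimpleGraph
open scoped Classical

/-- `F` is (the edge set of) a spanning forest of `G` whose trees correspond
bijectively to the parts of `P`, each part being contained in its tree: `F` is an
acyclic set of edges of `G` and there is a bijection `f` from the connected components
of the forest to the parts of `P` such that every vertex of a part lies in the
corresponding component. -/
def IsSpanningForestFor {V : Type} (G : SimpleGraph V) (P : Finset (Set V))
    (F : Set (Sym2 V)) : Prop :=
  F ⊆ G.edgeSet ∧ (SimpleGraph.fromEdgeSet F).IsAcyclic ∧
    ∃ f : (SimpleGraph.fromEdgeSet F).ConnectedComponent ≃ P,
      ∀ (c : (SimpleGraph.fromEdgeSet F).ConnectedComponent) (v : V),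
        v ∈ (f c : Set V) → (SimpleGraph.fromEdgeSet F).connectedComponentMk v = c

/-- The spanning forest polynomial `Φ_G^P = Σ_F ∏_{e ∉ F} α_e`, where the sum runs over
spanning forests `F` of `G` compatible with the partition `P`, viewed in the polynomial
ring with one variable for each element of `Sym2 V`. -/
noncomputable def forestPoly {V : Type} [Fintype V] (G : SimpleGraph V)
    (P : Finset (Set V)) : MvPolynomial (Sym2 V) ℤ :=
  ∑ F ∈ G.edgeFinset.powerset.filter
      (fun F : Finset (Sym2 V) => IsSpanningForestFor G P (F : Set (Sym2 V))),
    ∏ e ∈ G.edgeFinset \ F, MvPolynomial.X e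

/-- Every class of `R` contains exactly one part of `P`, and every part lies in one class. -/
structure ClassesMatch {V : Type*} (R : V → V → Prop) (P : Finset (Set V)) : Prop where
  rel : ∀ s ∈ P, ∀ y ∈ s, ∀ z ∈ s, R y z
  exists_part : ∀ x, ∃ s ∈ P, ∃ y ∈ s, R x y
  eq_of_rel : ∀ s ∈ P, ∀ t ∈ P, ∀ y ∈ s, ∀ z ∈ t, R y z → s = t

theorem exists_component_equiv_iff_classesMatch {V : Type} (H : SimpleGraph V)
    (P : Finset (Set V)) (hne : ∀ s ∈ P, s.Nonempty) :
    (∃ f : H.ConnectedComponent ≃ P, ∀ (c : H.ConnectedComponent) (v : V),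
      v ∈ (f c : Set V) → H.connectedComponentMk v = c) ↔ ClassesMatch H.Reachable P := by
  constructor
  · rintro ⟨f, hf⟩
    have hmk : ∀ (s : P) (y : V), y ∈ s.1 → H.connectedComponentMk y = f.symm s := by
      intro s y hy
      exact hf _ _ (by simpa using hy)
    refine ⟨fun s hs y hy z hz => ?_, fun x => ?_, fun s hs t ht y hy z hz hyz => ?_⟩
    · exact ConnectedComponent.exact ((hmk ⟨s, hs⟩ y hy).trans (hmk ⟨s, hs⟩ z hz).symm)
    · obtain ⟨y, hy⟩ := hne _ (f (H.connectedComponentMk x)).2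
      exact ⟨_, (f (H.connectedComponentMk x)).2, y, hy,
        (ConnectedComponent.exact (hf _ _ hy)).symm⟩
    · have h := ConnectedComponent.sound hyz
      rw [hmk ⟨s, hs⟩ y hy, hmk ⟨t, ht⟩ z hz] at h
      exact congrArg Subtype.val (f.symm.injective h)
  · intro h
    choose r hr using fun s : P => hne s.1 s.2
    have hbij : Function.Bijective fun s : P => H.connectedComponentMk (r s) := by
      refine ⟨fun s t hst => ?_, fun c => ?_⟩
      · exact Subtype.ext
          (h.eq_of_rel _ s.2 _ t.2 _ (hr s) _ (hr t) (ConnectedComponent.exact hst))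
      · induction c using ConnectedComponent.ind with
        | h x =>
          obtain ⟨s, hs, y, hy, hxy⟩ := h.exists_part x
          exact ⟨⟨s, hs⟩,
            ConnectedComponent.sound ((h.rel s hs _ (hr ⟨s, hs⟩) y hy).trans hxy.symm)⟩
    refine ⟨(Equiv.ofBijective _ hbij).symm, fun c x hx => ?_⟩
    obtain ⟨s, rfl⟩ := (Equiv.ofBijective _ hbij).surjective c
    rw [Equiv.symm_apply_apply] at hx
    exact ConnectedComponent.sound (h.rel s.1 s.2 _ hx _ (hr s))

theorem reachable_sup_edge_iff {V : Type*} {H : SimpleGraph V} {u v x y : V} :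
    (H ⊔ edge u v).Reachable x y ↔ H.Reachable x y ∨
      (H.Reachable x u ∧ H.Reachable v y) ∨ (H.Reachable x v ∧ H.Reachable u y) := by
  have hle : ∀ {a b}, H.Reachable a b → (H ⊔ edge u v).Reachable a b :=
    fun h => h.mono le_sup_left
  have huv : (H ⊔ edge u v).Reachable u v := by
    by_cases h : u = v
    · rw [h]
    · exact (show (H ⊔ edge u v).Adj u v by simp [edge_adj, h]).reachable
  constructor
  · rintro ⟨p⟩
    induction p with
    | nil => exact Or.inl (Reachable.refl _)
    | @cons a b c hab _ ih =>
      rw [sup_adj, edge_adj] at hab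
      rcases hab with hab | ⟨⟨rfl, rfl⟩ | ⟨rfl, rfl⟩, _⟩
      · have hr := hab.reachable
        rcases ih with h | ⟨h, h'⟩ | ⟨h, h'⟩
        · exact Or.inl (hr.trans h)
        · exact Or.inr (Or.inl ⟨hr.trans h, h'⟩)
        · exact Or.inr (Or.inr ⟨hr.trans h, h'⟩)
      · rcases ih with h | ⟨_, h'⟩ | ⟨_, h'⟩
        · exact Or.inr (Or.inl ⟨.refl _, h⟩)
        · exact Or.inr (Or.inl ⟨.refl _, h'⟩)
        · exact Or.inl h'
      · rcases ih with h | ⟨_, h'⟩ | ⟨_, h'⟩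
        · exact Or.inr (Or.inr ⟨.refl _, h⟩)
        · exact Or.inl h'
        · exact Or.inr (Or.inr ⟨.refl _, h'⟩)
  · rintro (h | ⟨h, h'⟩ | ⟨h, h'⟩)
    · exact hle h
    · exact (hle h).trans (huv.trans (hle h'))
    · exact (hle h).trans (huv.symm.trans (hle h'))

section Splitting

variable {V : Type*} {P : Finset (Set V)} {Q A : Set V} {u v : V} {R R' : V → V → Prop}

theorem ClassesMatch.split (hR : Equivalence R)
    (hR' : ∀ x y, R' x y ↔ R x y ∨ (R x u ∧ R v y) ∨ (R x v ∧ R u y))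
    (hQ : Q ∈ P) (hu : u ∈ Q) (hv : v ∈ Q) (huv : ¬ R u v) (h : ClassesMatch R' P) :
    ClassesMatch R (insert {y ∈ Q | R u y} (insert (Q \ {y ∈ Q | R u y}) (P.erase Q))) := by
  have symm : ∀ {a b}, R a b → R b a := hR.symm
  have trans : ∀ {a b c}, R a b → R b c → R a c := hR.trans
  have hvB : ∀ y ∈ Q, ¬ R u y → R v y := by
    intro y hy huy
    rcases (hR' u y).1 (h.rel Q hQ u hu y hy) with h1 | h1 | h1
    · exact (huy h1).elim
    · exact h1.2
    · exact (huv h1.1).elim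
  have hother : ∀ s ∈ P, s ≠ Q → ∀ y ∈ s, ∀ z ∈ Q, ¬ R' y z :=
    fun s hs hsQ y hy z hz hyz => hsQ (h.eq_of_rel s hs Q hQ y hy z hz hyz)
  refine ⟨fun s hs y hy z hz => ?_, fun x => ?_, fun s hs t ht y hy z hz hyz => ?_⟩
  · simp only [Finset.mem_insert, Finset.mem_erase] at hs
    rcases hs with rfl | rfl | ⟨hsQ, hs⟩
    · exact trans (symm hy.2) hz.2
    · exact trans (symm (hvB y hy.1 fun h => hy.2 ⟨hy.1, h⟩))
        (hvB z hz.1 fun h => hz.2 ⟨hz.1, h⟩)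
    · rcases (hR' y z).1 (h.rel s hs y hy z hz) with h1 | h1 | h1
      · exact h1
      · exact (hother s hs hsQ y hy u hu ((hR' _ _).2 (Or.inl h1.1))).elim
      · exact (hother s hs hsQ y hy v hv ((hR' _ _).2 (Or.inl h1.1))).elim
  · obtain ⟨s, hs, y, hy, hxy⟩ := h.exists_part x
    by_cases hx : R x u ∨ R x v
    · rcases hx with hx | hx
      · exact ⟨_, Finset.mem_insert_self _ _, u, ⟨hu, hR.refl u⟩, hx⟩
      · exact ⟨_, Finset.mem_insert_of_mem (Finset.mem_insert_self _ _), v,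
          ⟨hv, fun h => huv h.2⟩, hx⟩
    · push Not at hx
      have hxy : R x y := by
        rcases (hR' x y).1 hxy with h1 | h1 | h1
        · exact h1
        · exact (hx.1 h1.1).elim
        · exact (hx.2 h1.1).elim
      refine ⟨s, ?_, y, hy, hxy⟩
      have hsQ : s ≠ Q := by
        rintro rfl
        by_cases huy : R u y
        · exact hx.1 (trans hxy (symm huy))
        · exact hx.2 (trans hxy (symm (hvB y hy huy)))
      simp [hsQ, hs]
  · simp only [Finset.mem_insert, Finset.mem_erase] at hs ht
    have hyz' : R' y z := (hR' _ _).2 (Or.inl hyz)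
    have hzy' : R' z y := (hR' _ _).2 (Or.inl (symm hyz))
    rcases hs with rfl | rfl | ⟨hsQ, hs⟩ <;> rcases ht with rfl | rfl | ⟨htQ, ht⟩
    · rfl
    · exact (hz.2 ⟨hz.1, trans hy.2 hyz⟩).elim
    · exact (hother t ht htQ z hz y hy.1 hzy').elim
    · exact (hy.2 ⟨hy.1, trans hz.2 (symm hyz)⟩).elim
    · rfl
    · exact (hother t ht htQ z hz y hy.1 hzy').elim
    · exact (hother s hs hsQ y hy z hz.1 hyz').elim
    · exact (hother s hs hsQ y hy z hz.1 hyz').elim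
    · exact h.eq_of_rel s hs t ht y hy z hz hyz'

theorem ClassesMatch.not_rel_of_split (hv : v ∈ Q) (huA : u ∈ A) (hvA : v ∉ A)
    (h : ClassesMatch R (insert A (insert (Q \ A) (P.erase Q)))) : ¬ R u v := by
  intro huv
  have := h.eq_of_rel A (by simp) (Q \ A) (by simp) u huA v ⟨hv, hvA⟩ huv
  rw [this] at huA
  exact huA.2 (this ▸ huA)

theorem ClassesMatch.eq_of_split (hR : Equivalence R) (hv : v ∈ Q) (hAQ : A ⊆ Q)
    (huA : u ∈ A) (hvA : v ∉ A)
    (h : ClassesMatch R (insert A (insert (Q \ A) (P.erase Q)))) : A = {y ∈ Q | R u y} := by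
  ext y
  refine ⟨fun hy => ⟨hAQ hy, h.rel A (by simp) u huA y hy⟩, fun hy => ?_⟩
  by_contra hyA
  exact h.not_rel_of_split hv huA hvA
    (hR.trans hy.2 (h.rel (Q \ A) (by simp) y ⟨hy.1, hyA⟩ v ⟨hv, hvA⟩))

theorem ClassesMatch.of_split (hR : Equivalence R)
    (hR' : ∀ x y, R' x y ↔ R x y ∨ (R x u ∧ R v y) ∨ (R x v ∧ R u y))
    (hdisj : (P : Set (Set V)).Pairwise Disjoint)
    (hQ : Q ∈ P) (hv : v ∈ Q) (hAQ : A ⊆ Q) (huA : u ∈ A) (hvA : v ∉ A)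
    (h : ClassesMatch R (insert A (insert (Q \ A) (P.erase Q)))) : ClassesMatch R' P := by
  have symm : ∀ {a b}, R a b → R b a := hR.symm
  have trans : ∀ {a b c}, R a b → R b c → R a c := hR.trans
  have hA : ∀ y ∈ A, R u y := fun y hy => h.rel A (by simp) u huA y hy
  have hB : ∀ y ∈ Q, y ∉ A → R v y :=
    fun y hy hyA => h.rel (Q \ A) (by simp) v ⟨hv, hvA⟩ y ⟨hy, hyA⟩
  have hQuv : ∀ y ∈ Q, R u y ∨ R v y := fun y hy => by
    by_cases hyA : y ∈ A
    · exact Or.inl (hA y hyA)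
    · exact Or.inr (hB y hy hyA)
  have hmem : ∀ s ∈ P, s ≠ Q → s ∈ insert A (insert (Q \ A) (P.erase Q)) :=
    fun s hs hsQ => by simp [hs, hsQ]
  have hother : ∀ s ∈ P, s ≠ Q → ∀ y ∈ s, ¬ R u y ∧ ¬ R v y := by
    intro s hs hsQ y hy
    have hd := Set.disjoint_left.1 (hdisj hs hQ hsQ)
    refine ⟨fun huy => ?_, fun hvy => ?_⟩
    · have := h.eq_of_rel A (by simp) s (hmem s hs hsQ) u huA y hy huy
      exact hd hy (hAQ (this ▸ hy))
    · have := h.eq_of_rel (Q \ A) (by simp) s (hmem s hs hsQ) v ⟨hv, hvA⟩ y hy hvy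
      rw [← this] at hy
      exact hd (this ▸ hy) hy.1
  refine ⟨fun s hs y hy z hz => ?_, fun x => ?_, fun s hs t ht y hy z hz hyz => ?_⟩
  · rw [hR']
    by_cases hsQ : s = Q
    · subst hsQ
      rcases hQuv y hy with h1 | h1 <;> rcases hQuv z hz with h2 | h2
      · exact Or.inl (trans (symm h1) h2)
      · exact Or.inr (Or.inl ⟨symm h1, h2⟩)
      · exact Or.inr (Or.inr ⟨symm h1, h2⟩)
      · exact Or.inl (trans (symm h1) h2)
    · exact Or.inl (h.rel s (hmem s hs hsQ) y hy z hz)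
  · obtain ⟨s, hs, y, hy, hxy⟩ := h.exists_part x
    have hxy' : R' x y := (hR' _ _).2 (Or.inl hxy)
    simp only [Finset.mem_insert, Finset.mem_erase] at hs
    rcases hs with rfl | rfl | ⟨-, hs⟩
    · exact ⟨Q, hQ, y, hAQ hy, hxy'⟩
    · exact ⟨Q, hQ, y, hy.1, hxy'⟩
    · exact ⟨s, hs, y, hy, hxy'⟩
  · rw [hR'] at hyz
    by_cases hsQ : s = Q <;> by_cases htQ : t = Q
    · rw [hsQ, htQ]
    · subst hsQ
      have hz' := hother t ht htQ z hz
      rcases hyz with h1 | h1 | h1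
      · rcases hQuv y hy with h2 | h2
        · exact (hz'.1 (trans h2 h1)).elim
        · exact (hz'.2 (trans h2 h1)).elim
      · exact (hz'.2 h1.2).elim
      · exact (hz'.1 h1.2).elim
    · subst htQ
      have hy' := hother s hs hsQ y hy
      rcases hyz with h1 | h1 | h1
      · rcases hQuv z hz with h2 | h2
        · exact (hy'.1 (trans h2 (symm h1))).elim
        · exact (hy'.2 (trans h2 (symm h1))).elim
      · exact (hy'.1 (symm h1.1)).elim
      · exact (hy'.2 (symm h1.1)).elim
    · have hy' := hother s hs hsQ y hy
      rcases hyz with h1 | h1 | h1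
      · exact h.eq_of_rel s (hmem s hs hsQ) t (hmem t ht htQ) y hy z hz h1
      · exact (hy'.1 (symm h1.1)).elim
      · exact (hy'.2 (symm h1.1)).elim

end Splitting

theorem isSpanningForestFor_iff {V : Type} {G : SimpleGraph V} {P : Finset (Set V)}
    {F : Set (Sym2 V)} (hF : F ⊆ G.edgeSet) (hne : ∀ s ∈ P, s.Nonempty) :
    IsSpanningForestFor G P F ↔ (fromEdgeSet F).IsAcyclic ∧
      ClassesMatch (fromEdgeSet F).Reachable P := by
  rw [IsSpanningForestFor, exists_component_equiv_iff_classesMatch _ _ hne]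
  exact and_iff_right hF

theorem forestPoly_eq_sum_ite {V : Type} [Fintype V] (G : SimpleGraph V) [Fintype G.edgeSet]
    (P : Finset (Set V)) :
    forestPoly G P = ∑ F ∈ G.edgeFinset.powerset,
      if IsSpanningForestFor G P (F : Set (Sym2 V)) then
        ∏ e ∈ G.edgeFinset \ F, MvPolynomial.X e else 0 := by
  rw [forestPoly, Finset.sum_filter]
  congr!

theorem nonempty_of_mem_split {V : Type*} {P : Finset (Set V)} {Q A : Set V} {u v : V}
    (hne : ∀ s ∈ P, s.Nonempty) (hv : v ∈ Q) (huA : u ∈ A) (hvA : v ∉ A) :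
    ∀ s ∈ insert A (insert (Q \ A) (P.erase Q)), s.Nonempty := by
  intro s hs
  simp only [Finset.mem_insert, Finset.mem_erase] at hs
  rcases hs with rfl | rfl | ⟨-, hs⟩
  · exact ⟨u, huA⟩
  · exact ⟨v, hv, hvA⟩
  · exact hne s hs

theorem isSpanningForestFor_insert_iff {V : Type} {G : SimpleGraph V} {P : Finset (Set V)}
    (hne : ∀ s ∈ P, s.Nonempty) (hdisj : (P : Set (Set V)).Pairwise Disjoint) {u v : V}
    (huv : G.Adj u v) {Q : Set V} (hQ : Q ∈ P) (hu : u ∈ Q) (hv : v ∈ Q) {F : Set (Sym2 V)}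
    (hF : F ⊆ (G.deleteEdges {s(u, v)}).edgeSet) {A : Set V} :
    ((A ⊆ Q ∧ u ∈ A ∧ v ∉ A) ∧ IsSpanningForestFor (G.deleteEdges {s(u, v)})
      (insert A (insert (Q \ A) (P.erase Q))) F) ↔
      A = {y ∈ Q | (fromEdgeSet F).Reachable u y} ∧
        IsSpanningForestFor G P (insert s(u, v) F) := by
  have hFG : F ⊆ G.edgeSet := hF.trans (edgeSet_mono (deleteEdges_le _))
  have huvF : s(u, v) ∉ F := fun h => by simpa using hF h
  have hins : insert s(u, v) F ⊆ G.edgeSet := Set.insert_subset huv hFG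
  have hgraph : fromEdgeSet (insert s(u, v) F) = fromEdgeSet F ⊔ edge u v := by
    rw [edge, ← fromEdgeSet_union, Set.union_comm, Set.singleton_union]
  have hR := (fromEdgeSet F).reachable_is_equivalence
  have hR' : ∀ x y, (fromEdgeSet F ⊔ edge u v).Reachable x y ↔ _ :=
    fun x y => reachable_sup_edge_iff
  rw [isSpanningForestFor_iff hins hne, hgraph, isAcyclic_sup_fromEdgeSet_iff]
  constructor
  · rintro ⟨⟨hAQ, huA, hvA⟩, h⟩
    rw [isSpanningForestFor_iff hF (nonempty_of_mem_split hne hv huA hvA)] at h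
    exact ⟨h.2.eq_of_split hR hv hAQ huA hvA,
      ⟨h.1, fun h' => (h.2.not_rel_of_split hv huA hvA h').elim⟩,
      h.2.of_split hR hR' hdisj hQ hv hAQ huA hvA⟩
  · rintro ⟨rfl, ⟨hac, hred⟩, h⟩
    have hnr : ¬ (fromEdgeSet F).Reachable u v := by
      intro hr
      rcases hred hr with h1 | h1
      · exact huv.ne h1
      · exact huvF ((fromEdgeSet_adj _).1 h1).1
    have huA : u ∈ {y ∈ Q | (fromEdgeSet F).Reachable u y} := ⟨hu, .refl _⟩
    have hvA : v ∉ {y ∈ Q | (fromEdgeSet F).Reachable u y} := fun h => hnr h.2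
    refine ⟨⟨Set.sep_subset _ _, huA, hvA⟩, ?_⟩
    rw [isSpanningForestFor_iff hF (nonempty_of_mem_split hne hv huA hvA)]
    exact ⟨hac, h.split hR hR' hQ hu hv hnr⟩

/-- Deletion–contraction for spanning forest polynomials, for an edge `e = {u,v}` whose
endpoints lie in the same part `Pi` of `P`:
`Φ_G^P = α_e Φ_{G∖e}^P + Σ_{(A,B)} Φ_{G∖e}^{(P ∖ {Pi}) ∪ {A,B}}`, the sum being over all
splittings of `Pi` into disjoint nonempty sets `A ∪ B = Pi` with `u ∈ A` and `v ∈ B`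
(such a splitting is determined by `A`, with `B = Pi ∖ A`). -/
theorem forestPoly_deletion_contraction {V : Type} [Fintype V] (G : SimpleGraph V)
    (P : Finset (Set V)) (hne : ∀ s ∈ P, s.Nonempty)
    (hdisj : (P : Set (Set V)).Pairwise Disjoint)
    (u v : V) (huv : G.Adj u v) (Pi : Set V) (hPi : Pi ∈ P) (hu : u ∈ Pi) (hv : v ∈ Pi) :
    forestPoly G P =
      MvPolynomial.X s(u, v) * forestPoly (G.deleteEdges {s(u, v)}) P +
      ∑ A ∈ Finset.univ.filter (fun A : Set V => A ⊆ Pi ∧ u ∈ A ∧ v ∉ A),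
        forestPoly (G.deleteEdges {s(u, v)})
          (insert A (insert (Pi \ A) (P.erase Pi))) := by
  have hE : G.edgeFinset = insert s(u, v) (G.deleteEdges {s(u, v)}).edgeFinset := by
    ext e
    by_cases he : e = s(u, v) <;> simp [he, huv]
  have huvE : s(u, v) ∉ (G.deleteEdges {s(u, v)}).edgeFinset := by simp
  have hsub : ∀ F ∈ (G.deleteEdges {s(u, v)}).edgeFinset.powerset,
      (F : Set (Sym2 V)) ⊆ (G.deleteEdges {s(u, v)}).edgeSet := fun F hF e he => by
    simpa only [mem_edgeFinset] using Finset.mem_powerset.1 hF he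
  simp only [forestPoly_eq_sum_ite]
  rw [hE, Finset.sum_powerset_insert huvE, Finset.mul_sum]
  congr 1
  · refine Finset.sum_congr rfl fun F hF => ?_
    have hFG : (F : Set (Sym2 V)) ⊆ G.edgeSet :=
      (hsub F hF).trans (edgeSet_mono (deleteEdges_le _))
    rw [Finset.insert_sdiff_of_notMem _ fun h => huvE (Finset.mem_powerset.1 hF h),
      Finset.prod_insert fun h => huvE (Finset.mem_sdiff.1 h).1, mul_ite, mul_zero]
    exact if_congr (by
      rw [isSpanningForestFor_iff hFG hne, isSpanningForestFor_iff (hsub F hF) hne]) rfl rfl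
  · rw [Finset.sum_comm]
    refine Finset.sum_congr rfl fun F hF => ?_
    rw [Finset.insert_sdiff_insert, Finset.sdiff_insert_of_notMem huvE, Finset.coe_insert,
      Finset.sum_filter]
    simp only [← ite_and, isSpanningForestFor_insert_iff hne hdisj huv hPi hu hv (hsub F hF)]
    simp only [ite_and, Finset.sum_ite_eq', Finset.mem_univ, if_true]
end
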